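/- Let B ∈ C²((0,∞)) ∩ C¹([0,∞)) with B(0) = 0, and suppose there exist constants c'' > 0 and p* ≥ 1 such that B''(t) ≥ c'' t^{p*−2} for all t ∈ (0, M], where M > 0. Then there exists ε > 0 such that B'(t)·t − B(t) ≥ ε t^{p*} for all t ∈ [0, M]. -/

import Mathlib

/-- If `B ∈ C¹([0,∞)) ∩ C²((0,∞))`, `B(0) = 0`, and `B''(t) ≥ c'' t^{p*-2}` on
`(0, M]` for some `c'' > 0` and `p* ≥ 1`, then there is `ε > 0` with
`B'(t) t - B(t) ≥ ε t^{p*}` on `[0, M]`. -/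
theorem b_lower_bound
    (B : ℝ → ℝ) (M c'' pstar : ℝ)
    (hM : 0 < M) (hc : 0 < c'') (hp : 1 ≤ pstar)
    (hB1 : ContDiffOn ℝ 1 B (Set.Ici 0))
    (hB2 : ContDiffOn ℝ 2 B (Set.Ioi 0))
    (hB0 : B 0 = 0)
    (hB'' : ∀ t : ℝ, t ∈ Set.Ioc 0 M → c'' * t ^ (pstar - 2) ≤ deriv (deriv B) t) :
    ∃ ε : ℝ, 0 < ε ∧ ∀ t : ℝ, t ∈ Set.Icc 0 M →
      ε * t ^ pstar ≤ deriv B t * t - B t := by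
  have hp0 : 0 < pstar := by linarith
  have hD : ∀ t : ℝ, 0 < t → derivWithin B (Set.Ici 0) t = deriv B t := fun t ht =>
    derivWithin_of_mem_nhds (Ici_mem_nhds ht)
  have hcont : ContinuousOn (derivWithin B (Set.Ici 0)) (Set.Ici 0) :=
    hB1.continuousOn_derivWithin (uniqueDiffOn_Ici 0) le_rfl
  have hd1 : ∀ t : ℝ, 0 < t → HasDerivAt B (deriv B t) t := fun t ht =>
    ((hB2.differentiableOn (by norm_num)).differentiableAt (Ioi_mem_nhds ht)).hasDerivAt
  have hC1 : ContDiffOn ℝ 1 (deriv B) (Set.Ioi 0) :=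
    hB2.deriv_of_isOpen isOpen_Ioi (by norm_num)
  have hd2 : ∀ t : ℝ, 0 < t → HasDerivAt (deriv B) (deriv (deriv B) t) t := fun t ht =>
    ((hC1.differentiableOn (by norm_num)).differentiableAt (Ioi_mem_nhds ht)).hasDerivAt
  let g : ℝ → ℝ := fun t => derivWithin B (Set.Ici 0) t * t - B t - c'' / pstar * t ^ pstar
  have hg' : ∀ t : ℝ, 0 < t →
      HasDerivAt g (deriv (deriv B) t * t - c'' * t ^ (pstar - 1)) t := by
    intro t ht
    have h := (((hd2 t ht).mul (hasDerivAt_id t)).sub (hd1 t ht)).sub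
      ((Real.hasDerivAt_rpow_const (p := pstar) (Or.inl ht.ne')).const_mul (c'' / pstar))
    have h2 := h.congr_of_eventuallyEq (f₁ := g) (by
      filter_upwards [Ioi_mem_nhds ht] with x hx
      simp [g, hD x hx])
    have e : deriv (deriv B) t * id t + deriv B t * 1 - deriv B t -
        c'' / pstar * (pstar * t ^ (pstar - 1)) =
        deriv (deriv B) t * t - c'' * t ^ (pstar - 1) := by
      simp only [id]
      field_simp
      ring
    rw [← e]
    exact h2
  have hmono : MonotoneOn g (Set.Icc 0 M) := by
    apply monotoneOn_of_deriv_nonneg (convex_Icc 0 M)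
    · have hsub : Set.Icc 0 M ⊆ Set.Ici (0 : ℝ) := fun x hx => hx.1
      exact (((hcont.mono hsub).mul continuousOn_id).sub (hB1.continuousOn.mono hsub)).sub
        (continuousOn_const.mul (Real.continuous_rpow_const hp0.le).continuousOn)
    · intro x hx
      rw [interior_Icc] at hx
      exact (hg' x hx.1).differentiableAt.differentiableWithinAt
    · intro x hx
      rw [interior_Icc] at hx
      rw [(hg' x hx.1).deriv]
      have h := mul_le_mul_of_nonneg_right (hB'' x ⟨hx.1, hx.2.le⟩) hx.1.le
      have e : x ^ (pstar - 1) = x ^ (pstar - 2) * x := by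
        rw [← Real.rpow_add_one hx.1.ne']
        congr 1
        ring
      rw [e]
      linarith
  refine ⟨c'' / pstar, div_pos hc hp0, ?_⟩
  intro t ht
  rcases ht.1.eq_or_lt with h0 | h0
  · subst h0
    simp [hB0, Real.zero_rpow hp0.ne']
  · have h := hmono ⟨le_rfl, hM.le⟩ ht ht.1
    simp only [g, hB0, Real.zero_rpow hp0.ne', hD t h0] at h
    linarith
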